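/- Termination: for every Partitioned CPS program, the summarization algorithm terminates. More precisely, the set of local states of a program is finite, hence the set of ordered pairs of local states is finite; since an edge is marked as seen when it is inserted into the workset W and no edge is ever inserted into W twice, the main loop removes an edge from W only finitely many times and the algorithm halts. -/

import Mathlib

set_option autoImplicit true
set_option maxHeartbeats 1000000

namespace CFA2

/-! ## Syntax of Partitioned CPS -/

abbrev UVar := ℕ
abbrev CVar := ℕ
abbrev Lab := ℕ
abbrev Var := UVar ⊕ CVar

mutual
  inductive ULam : Type
    | mk (l : Lab) (u : UVar) (k : CVar) (body : Call)
  inductive CLam : Type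
    | mk (g : Lab) (u : UVar) (body : Call)
  inductive UExp : Type
    | lam (f : ULam)
    | var (v : UVar)
  inductive CExp : Type
    | lam (f : CLam)
    | var (k : CVar)
  inductive Call : Type
    | u (l : Lab) (f : UExp) (e : UExp) (q : CExp)
    | c (g : Lab) (q : CExp) (e : UExp)
end

def Call.lab : Call → Lab
  | .u l _ _ _ => l
  | .c g _ _ => g

-- Bound variables of a term.
mutual
  def ULam.bv : ULam → Set Var
    | .mk _ u k body => insert (Sum.inl u) (insert (Sum.inr k) (Call.bv body))
  def CLam.bv : CLam → Set Var
    | .mk _ u body => insert (Sum.inl u) (Call.bv body)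
  def UExp.bv : UExp → Set Var
    | .lam f => ULam.bv f
    | .var _ => ∅
  def CExp.bv : CExp → Set Var
    | .lam f => CLam.bv f
    | .var _ => ∅
  def Call.bv : Call → Set Var
    | .u _ f e q => UExp.bv f ∪ UExp.bv e ∪ CExp.bv q
    | .c _ q e => CExp.bv q ∪ UExp.bv e
end

-- The list of all binding occurrences of variables.
mutual
  def ULam.binders : ULam → List Var
    | .mk _ u k body => Sum.inl u :: Sum.inr k :: Call.binders body
  def CLam.binders : CLam → List Var
    | .mk _ u body => Sum.inl u :: Call.binders body
  def UExp.binders : UExp → List Var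
    | .lam f => ULam.binders f
    | .var _ => []
  def CExp.binders : CExp → List Var
    | .lam f => CLam.binders f
    | .var _ => []
  def Call.binders : Call → List Var
    | .u _ f e q => UExp.binders f ++ UExp.binders e ++ CExp.binders q
    | .c _ q e => CExp.binders q ++ UExp.binders e
end

/-- A program is alphatized: all variables have distinct names. -/
def Alphatized (pr : ULam) : Prop := (ULam.binders pr).Nodup

/-! ## Label groups, LV, LL, stack/heap references -/

-- Labels of a term that belong to the group of the enclosing user lambda
-- (we do not descend into nested user lambdas).
mutual
  def ULam.groupLabs : ULam → Set Lab
    | .mk l _ _ body => insert l (Call.topLabs body)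
  def CLam.topLabs : CLam → Set Lab
    | .mk g _ body => insert g (Call.topLabs body)
  def UExp.topLabs : UExp → Set Lab
    | .lam _ => ∅
    | .var _ => ∅
  def CExp.topLabs : CExp → Set Lab
    | .lam f => CLam.topLabs f
    | .var _ => ∅
  def Call.topLabs : Call → Set Lab
    | .u l f e q => insert l (UExp.topLabs f ∪ UExp.topLabs e ∪ CExp.topLabs q)
    | .c g q e => insert g (CExp.topLabs q ∪ UExp.topLabs e)
end

-- Variables bound by the lambdas whose labels belong to the group of the
-- enclosing user lambda.
mutual
  def ULam.groupVars : ULam → Set Var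
    | .mk _ u k body => insert (Sum.inl u) (insert (Sum.inr k) (Call.topVars body))
  def CLam.topVars : CLam → Set Var
    | .mk _ u body => insert (Sum.inl u) (Call.topVars body)
  def UExp.topVars : UExp → Set Var
    | .lam _ => ∅
    | .var _ => ∅
  def CExp.topVars : CExp → Set Var
    | .lam f => CLam.topVars f
    | .var _ => ∅
  def Call.topVars : Call → Set Var
    | .u _ f e q => UExp.topVars f ∪ UExp.topVars e ∪ CExp.topVars q
    | .c _ q e => CExp.topVars q ∪ UExp.topVars e
end

-- User lambdas occurring as subterms.
mutual
  def ULam.subULams : ULam → Set ULam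
    | .mk l u k body => insert (.mk l u k body) (Call.subULams body)
  def CLam.subULams : CLam → Set ULam
    | .mk _ _ body => Call.subULams body
  def UExp.subULams : UExp → Set ULam
    | .lam f => ULam.subULams f
    | .var _ => ∅
  def CExp.subULams : CExp → Set ULam
    | .lam f => CLam.subULams f
    | .var _ => ∅
  def Call.subULams : Call → Set ULam
    | .u _ f e q => UExp.subULams f ∪ UExp.subULams e ∪ CExp.subULams q
    | .c _ q e => CExp.subULams q ∪ UExp.subULams e
end

-- Continuation lambdas occurring as subterms.
mutual
  def ULam.subCLams : ULam → Set CLam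
    | .mk _ _ _ body => Call.subCLams body
  def CLam.subCLams : CLam → Set CLam
    | .mk g u body => insert (.mk g u body) (Call.subCLams body)
  def UExp.subCLams : UExp → Set CLam
    | .lam f => ULam.subCLams f
    | .var _ => ∅
  def CExp.subCLams : CExp → Set CLam
    | .lam f => CLam.subCLams f
    | .var _ => ∅
  def Call.subCLams : Call → Set CLam
    | .u _ f e q => UExp.subCLams f ∪ UExp.subCLams e ∪ CExp.subCLams q
    | .c _ q e => CExp.subCLams q ∪ UExp.subCLams e
end

-- Call sites occurring as subterms.
mutual
  def ULam.subCalls : ULam → Set Call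
    | .mk _ _ _ body => Call.subCalls body
  def CLam.subCalls : CLam → Set Call
    | .mk _ _ body => Call.subCalls body
  def UExp.subCalls : UExp → Set Call
    | .lam f => ULam.subCalls f
    | .var _ => ∅
  def CExp.subCalls : CExp → Set Call
    | .lam f => CLam.subCalls f
    | .var _ => ∅
  def Call.subCalls : Call → Set Call
    | .u l f e q => insert (.u l f e q) (UExp.subCalls f ∪ UExp.subCalls e ∪ CExp.subCalls q)
    | .c g q e => insert (.c g q e) (CExp.subCalls q ∪ UExp.subCalls e)
end

/-- `LV pr ψ`: the variables bound by the lambdas whose labels lie in the same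
group as label `ψ` (labels grouped by innermost enclosing user lambda). -/
def LV (pr : ULam) (ψ : Lab) : Set Var :=
  {v | ∃ ul ∈ ULam.subULams pr, ψ ∈ ULam.groupLabs ul ∧ v ∈ ULam.groupVars ul}

/-- `LL pr ψ`: the labels in the same group as `ψ`. -/
def LL (pr : ULam) (ψ : Lab) : Set Lab :=
  {ψ' | ∃ ul ∈ ULam.subULams pr, ψ ∈ ULam.groupLabs ul ∧ ψ' ∈ ULam.groupLabs ul}

-- Variables referenced (as immediate operands) at a call site.
def UExp.refVars : UExp → Set Var
  | .var v => {Sum.inl v}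
  | .lam _ => ∅
def CExp.refVars : CExp → Set Var
  | .var k => {Sum.inr k}
  | .lam _ => ∅
def Call.refVars : Call → Set Var
  | .u _ f e q => UExp.refVars f ∪ UExp.refVars e ∪ CExp.refVars q
  | .c _ q e => CExp.refVars q ∪ UExp.refVars e

/-- A heap variable: a user variable some of whose references are heap references. -/
def HVar (pr : ULam) (u : UVar) : Prop :=
  ∃ call ∈ ULam.subCalls pr, Sum.inl u ∈ Call.refVars call ∧ Sum.inl u ∉ LV pr (Call.lab call)

/-! ## Concrete semantics (Fig. 2) -/

abbrev Time := List Lab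
abbrev BEnv := Var → Option Time

structure UClos where
  lam : ULam
  env : BEnv

inductive CClos : Type
  | clo (lam : CLam) (env : BEnv)
  | halt

abbrev Clos := UClos ⊕ CClos
abbrev VEnv := Var → Time → Option Clos

def updB (β : BEnv) (v : Var) (t : Time) : BEnv :=
  fun x => if x = v then some t else β x

def updVE (ve : VEnv) (v : Var) (t : Time) (cl : Clos) : VEnv :=
  fun x s => if x = v ∧ s = t then some cl else ve x s

def emptyBE : BEnv := fun _ => none
def emptyVE : VEnv := fun _ _ => none

/-- Concrete evaluation of user expressions (the function `A` of Fig. 2). -/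
inductive EvUC (β : BEnv) (ve : VEnv) : UExp → UClos → Prop
  | lam (f : ULam) : EvUC β ve (.lam f) ⟨f, β⟩
  | var (v : UVar) (t : Time) (cl : UClos) :
      β (Sum.inl v) = some t → ve (Sum.inl v) t = some (.inl cl) →
      EvUC β ve (.var v) cl

/-- Concrete evaluation of continuation expressions. -/
inductive EvCC (β : BEnv) (ve : VEnv) : CExp → CClos → Prop
  | lam (f : CLam) : EvCC β ve (.lam f) (.clo f β)
  | var (k : CVar) (t : Time) (cl : CClos) :
      β (Sum.inr k) = some t → ve (Sum.inr k) t = some (.inr cl) →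
      EvCC β ve (.var k) cl

/-- Concrete states. -/
inductive CState : Type
  | eval (call : Call) (β : BEnv) (ve : VEnv) (t : Time)
  | applyU (proc : UClos) (d : UClos) (c : CClos) (ve : VEnv) (t : Time)
  | applyC (proc : CClos) (d : UClos) (ve : VEnv) (t : Time)

def veOf : CState → VEnv
  | .eval _ _ ve _ => ve
  | .applyU _ _ _ ve _ => ve
  | .applyC _ _ ve _ => ve

/-- The concrete transition relation (Fig. 2). -/
inductive CStep : CState → CState → Prop
  | uea : EvUC β ve f proc → EvUC β ve e d → EvCC β ve q c →
      CStep (.eval (.u l f e q) β ve t) (.applyU proc d c ve (l :: t))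
  | uae : CStep (.applyU ⟨.mk l u k body, β⟩ d c ve t)
      (.eval body (updB (updB β (Sum.inl u) t) (Sum.inr k) t)
        (updVE (updVE ve (Sum.inl u) t (.inl d)) (Sum.inr k) t (.inr c)) t)
  | cea : EvCC β ve q proc → EvUC β ve e d →
      CStep (.eval (.c g q e) β ve t) (.applyC proc d ve (g :: t))
  | cae : CStep (.applyC (.clo (.mk g u body) β) d ve t)
      (.eval body (updB β (Sum.inl u) t) (updVE ve (Sum.inl u) t (.inl d)) t)

/-- Initial concrete state of program `pr` on input `inp`. -/
def initC (pr inp : ULam) : CState :=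
  .applyU ⟨pr, emptyBE⟩ ⟨inp, emptyBE⟩ .halt emptyVE []

/-- Domain of a binding environment. -/
def domB (β : BEnv) : Set Var := {v | β v ≠ none}

/-! ## Abstract semantics (Fig. 4) -/

/-- Abstract user values: sets of user lambdas. -/
abbrev D := Set ULam

/-- Abstract continuations: a continuation lambda or halt. -/
inductive CAbs : Type
  | clam (f : CLam)
  | halt

/-- A frame maps user variables to abstract user values and continuation
variables to abstract continuations. -/
structure Frame where
  u : UVar → Option D
  k : CVar → Option CAbs

abbrev Stack := List Frame
abbrev Heap := UVar → Option D

def Frame.updU (tf : Frame) (v : UVar) (d : D) : Frame :=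
  ⟨fun x => if x = v then some d else tf.u x, tf.k⟩

def mkFrame (u : UVar) (d : D) (k : CVar) (c : CAbs) : Frame :=
  ⟨fun x => if x = u then some d else none, fun x => if x = k then some c else none⟩

/-- Heap join `h ⊔ [v ↦ d]`. -/
def hjoin (h : Heap) (v : UVar) (d : D) : Heap :=
  fun x => if x = v then some (d ∪ (h v).getD ∅) else h x

/-- Abstract states. -/
inductive AState : Type
  | eval (call : Call) (st : Stack) (h : Heap)
  | applyU (f : ULam) (d : D) (c : CAbs) (st : Stack) (h : Heap)
  | applyC (c : CAbs) (d : D) (st : Stack) (h : Heap)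

instance : Inhabited AState := ⟨.applyC .halt ∅ [] (fun _ => none)⟩

def stackOf : AState → Stack
  | .eval _ st _ => st
  | .applyU _ _ _ st _ => st
  | .applyC _ _ st _ => st

def setStack : AState → Stack → AState
  | .eval c _ h, st => .eval c st h
  | .applyU f d cc _ h, st => .applyU f d cc st h
  | .applyC cc d _ h, st => .applyC cc d st h

/-- Abstract evaluation of a user expression at call site `ψ`:
lambdas evaluate to singletons, stack references are looked up in the top
frame and heap references in the heap. -/
inductive AEvalU (pr : ULam) : UExp → Lab → Stack → Heap → D → Prop
  | lam (f : ULam) (ψ : Lab) (st : Stack) (h : Heap) :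
      AEvalU pr (.lam f) ψ st h {f}
  | stk (v : UVar) (ψ : Lab) (tf : Frame) (st : Stack) (h : Heap) (d : D) :
      Sum.inl v ∈ LV pr ψ → tf.u v = some d →
      AEvalU pr (.var v) ψ (tf :: st) h d
  | hp (v : UVar) (ψ : Lab) (st : Stack) (h : Heap) (d : D) :
      Sum.inl v ∉ LV pr ψ → h v = some d →
      AEvalU pr (.var v) ψ st h d

/-- The abstract transition relation of CFA2 (Fig. 4). -/
inductive AStep (pr : ULam) : AState → AState → Prop
  | uea_tail :
      AEvalU pr f l (tf :: st) h df → ulam ∈ df →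
      AEvalU pr e l (tf :: st) h d →
      tf.k kv = some c →
      AStep pr (.eval (.u l f e (.var kv)) (tf :: st) h) (.applyU ulam d c st h)
  | uea_flam :
      AEvalU pr e l st h d →
      AStep pr (.eval (.u l (.lam ulam) e (.lam cl)) st h)
               (.applyU ulam d (.clam cl) st h)
  | uea_fheap :
      Sum.inl fv ∉ LV pr l → h fv = some df → ulam ∈ df →
      AEvalU pr e l st h d →
      AStep pr (.eval (.u l (.var fv) e (.lam cl)) st h)
               (.applyU ulam d (.clam cl) st h)
  | uea_fstk :
      Sum.inl fv ∈ LV pr l → tf.u fv = some df → ulam ∈ df →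
      AEvalU pr e l (tf :: st) h d →
      AStep pr (.eval (.u l (.var fv) e (.lam cl)) (tf :: st) h)
               (.applyU ulam d (.clam cl) (Frame.updU tf fv {ulam} :: st) h)
  | uae_h :
      HVar pr u →
      AStep pr (.applyU (.mk l u k body) d c st h)
               (.eval body (mkFrame u d k c :: st) (hjoin h u d))
  | uae_s :
      ¬ HVar pr u →
      AStep pr (.applyU (.mk l u k body) d c st h)
               (.eval body (mkFrame u d k c :: st) h)
  | cea_var :
      tf.k kv = some c → AEvalU pr e g (tf :: st) h d →
      AStep pr (.eval (.c g (.var kv) e) (tf :: st) h) (.applyC c d st h)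
  | cea_lam :
      AEvalU pr e g st h d →
      AStep pr (.eval (.c g (.lam cl) e) st h) (.applyC (.clam cl) d st h)
  | cae_h :
      HVar pr u →
      AStep pr (.applyC (.clam (.mk g u body)) d (tf :: st) h)
               (.eval body (Frame.updU tf u d :: st) (hjoin h u d))
  | cae_s :
      ¬ HVar pr u →
      AStep pr (.applyC (.clam (.mk g u body)) d (tf :: st) h)
               (.eval body (Frame.updU tf u d :: st) h)

/-! ### Classification of abstract states -/

def IsEntry : AState → Prop
  | .applyU _ _ _ _ _ => True
  | _ => False
def IsExitCEval : AState → Prop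
  | .eval (.c _ (.var _) _) _ _ => True
  | _ => False
def IsTailCall : AState → Prop
  | .eval (.u _ _ _ (.var _)) _ _ => True
  | _ => False
def IsCall : AState → Prop
  | .eval (.u _ _ _ (.lam _)) _ _ => True
  | _ => False
def IsFinal : AState → Prop
  | .applyC .halt _ [] _ => True
  | _ => False

/-- Domain of a frame. -/
def domFrame (tf : Frame) : Set Var :=
  {v | ∃ u, v = Sum.inl u ∧ tf.u u ≠ none} ∪ {v | ∃ k, v = Sum.inr k ∧ tf.k k ≠ none}

/-! ### The order ⊑ on abstract states (Fig. 5) -/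

def FrameLE (f1 f2 : Frame) : Prop :=
  (∀ v d, f1.u v = some d → ∃ d', f2.u v = some d' ∧ d ⊆ d') ∧
  (∀ kv c, f1.k kv = some c → f2.k kv = some c)

def StackLE : Stack → Stack → Prop
  | [], [] => True
  | f1 :: s1, f2 :: s2 => FrameLE f1 f2 ∧ StackLE s1 s2
  | _, _ => False

def HeapLE (h1 h2 : Heap) : Prop :=
  ∀ v d, h1 v = some d → ∃ d', h2 v = some d' ∧ d ⊆ d'

def AStateLE : AState → AState → Prop
  | .eval c1 s1 h1, .eval c2 s2 h2 => c1 = c2 ∧ StackLE s1 s2 ∧ HeapLE h1 h2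
  | .applyU f1 d1 c1 s1 h1, .applyU f2 d2 c2 s2 h2 =>
      f1 = f2 ∧ d1 ⊆ d2 ∧ c1 = c2 ∧ StackLE s1 s2 ∧ HeapLE h1 h2
  | .applyC c1 d1 s1 h1, .applyC c2 d2 s2 h2 =>
      c1 = c2 ∧ d1 ⊆ d2 ∧ StackLE s1 s2 ∧ HeapLE h1 h2
  | _, _ => False

/-! ## Abstraction map |·|_ca from concrete to abstract states (Fig. 6) -/

def absU (cl : UClos) : D := {cl.lam}

def absC : CClos → CAbs
  | .clo f _ => .clam f
  | .halt => .halt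

open Classical in
/-- Abstraction of a variable environment: keep only heap variables, joining
over all times. -/
noncomputable def absVE (pr : ULam) (ve : VEnv) : Heap := fun v =>
  if HVar pr v then
    some {ul | ∃ t β', ve (Sum.inl v) t = some (.inl ⟨ul, β'⟩)}
  else none

open Classical in
/-- The user-variable part of the frame built by `toStack` for the variable
set `vs`: each user variable of `vs` in the domain of `β` is mapped to the
abstraction of its concrete value. -/
noncomputable def absEntryU (vs : Set Var) (β : BEnv) (ve : VEnv) : UVar → Option D :=
  fun v =>
    if Sum.inl v ∈ vs then
      (β (Sum.inl v)).bind fun t =>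
        (ve (Sum.inl v) t).bind fun cl =>
          match cl with
          | .inl ucl => some {ucl.lam}
          | .inr _ => none
    else none

/-- `ToStack pr ve vs β st`: `st` is the stack reconstructed from `β` and `ve`
for the variable set `vs` (the relation `toStack` of Fig. 6). -/
inductive ToStack (pr : ULam) (ve : VEnv) : Set Var → BEnv → Stack → Prop
  | halt (vs : Set Var) (β : BEnv) (kv : CVar) (t : Time) :
      Sum.inr kv ∈ vs →
      β (Sum.inr kv) = some t →
      ve (Sum.inr kv) t = some (.inr .halt) →
      ToStack pr ve vs β
        [⟨absEntryU vs β ve, fun x => if x = kv then some .halt else none⟩]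
  | cons (vs : Set Var) (β β' : BEnv) (kv : CVar) (t : Time) (g : Lab)
      (u : UVar) (body : Call) (st : Stack) :
      Sum.inr kv ∈ vs →
      β (Sum.inr kv) = some t →
      ve (Sum.inr kv) t = some (.inr (.clo (.mk g u body) β')) →
      ToStack pr ve (LV pr g) β' st →
      ToStack pr ve vs β
        (⟨absEntryU vs β ve,
          fun x => if x = kv then some (.clam (.mk g u body)) else none⟩ :: st)

/-- `CA pr ς ς̂`: `ς̂` is the abstraction `|ς|_ca` of the concrete state `ς`. -/
inductive CA (pr : ULam) : CState → AState → Prop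
  | eval (call : Call) (β : BEnv) (ve : VEnv) (t : Time) (st : Stack) :
      ToStack pr ve (LV pr (Call.lab call)) β st →
      CA pr (.eval call β ve t) (.eval call st (absVE pr ve))
  | applyU_halt (f : ULam) (β : BEnv) (d : UClos) (ve : VEnv) (t : Time) :
      CA pr (.applyU ⟨f, β⟩ d .halt ve t)
            (.applyU f (absU d) .halt [] (absVE pr ve))
  | applyU_clo (f : ULam) (β β' : BEnv) (d : UClos) (g : Lab) (u : UVar)
      (body : Call) (ve : VEnv) (t : Time) (st : Stack) :
      ToStack pr ve (LV pr g) β' st →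
      CA pr (.applyU ⟨f, β⟩ d (.clo (.mk g u body) β') ve t)
            (.applyU f (absU d) (.clam (.mk g u body)) st (absVE pr ve))
  | applyC_halt (d : UClos) (ve : VEnv) (t : Time) :
      CA pr (.applyC .halt d ve t) (.applyC .halt (absU d) [] (absVE pr ve))
  | applyC_clo (g : Lab) (u : UVar) (body : Call) (β : BEnv) (d : UClos)
      (ve : VEnv) (t : Time) (st : Stack) :
      ToStack pr ve (LV pr g) β st →
      CA pr (.applyC (.clo (.mk g u body) β) d ve t)
            (.applyC (.clam (.mk g u body)) (absU d) st (absVE pr ve))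

/-! ## Paths and push monotonicity -/

/-- `PushMono ste p`: every transition in `p` whose source has stack exactly
`ste` only pushes — it neither pops nor modifies the top frame. -/
def PushMono (ste : Stack) (p : List AState) : Prop :=
  ∀ i, i + 1 < p.length →
    stackOf (p.getD i default) = ste →
    ∃ ext, stackOf (p.getD (i + 1) default) = ext ++ ste

/-! ## Corresponding entries `CE` and `CE*` -/

mutual
  /-- `CE p j i`: the state at position `j` is the corresponding entry of the
  state at position `i` in path `p`. -/
  inductive CE (p : List AState) : ℕ → ℕ → Prop
    | entry (i : ℕ) :
        i < p.length → IsEntry (p.getD i default) → CE p i i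
    | inner (j i : ℕ) :
        i < p.length → 0 < i → ¬ IsEntry (p.getD i default) →
        ¬ IsExitCEval (p.getD (i - 1) default) →
        CE p j (i - 1) → CE p j i
    | callret (j m i : ℕ) :
        i < p.length → 0 < i → ¬ IsEntry (p.getD i default) →
        j < m → m + 3 ≤ i →
        IsCall (p.getD m default) → IsExitCEval (p.getD (i - 1) default) →
        CE p j m → CEstar p (m + 1) (i - 1) → CE p j i

  /-- `CEstar p j i`: the state at position `j` belongs to `CE*` of the state
  at position `i` in path `p`. -/
  inductive CEstar (p : List AState) : ℕ → ℕ → Prop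
    | base (j i : ℕ) : CE p j i → CEstar p j i
    | tail (j m i : ℕ) :
        m + 1 ≤ i → IsTailCall (p.getD m default) →
        IsEntry (p.getD (m + 1) default) → CE p (m + 1) i →
        CEstar p j m → CEstar p j i
end

/-! ## Local semantics (Fig. 7) -/

abbrev LFrame := UVar → Option D

/-- Local states: a single frame of user bindings instead of a stack. -/
inductive LState : Type
  | eval (call : Call) (tf : LFrame) (h : Heap)
  | applyU (f : ULam) (d : D) (h : Heap)
  | applyC (c : CAbs) (d : D) (tf : LFrame) (h : Heap)

instance : Inhabited LState := ⟨.applyC .halt ∅ (fun _ => none) (fun _ => none)⟩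

def topU : Stack → LFrame
  | [] => fun _ => none
  | tf :: _ => tf.u

/-- The map `|·|_al` from abstract to local states. -/
def toLocal : AState → LState
  | .eval call st h => .eval call (topU st) h
  | .applyU f d _ _ h => .applyU f d h
  | .applyC c d st h => .applyC c d (topU st) h

def updL (tf : LFrame) (v : UVar) (d : D) : LFrame :=
  fun x => if x = v then some d else tf x

/-- Local abstract evaluation of user expressions. -/
inductive LEvalU (pr : ULam) : UExp → Lab → LFrame → Heap → D → Prop
  | lam (f : ULam) (ψ : Lab) (tf : LFrame) (h : Heap) :
      LEvalU pr (.lam f) ψ tf h {f}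
  | stk (v : UVar) (ψ : Lab) (tf : LFrame) (h : Heap) (d : D) :
      Sum.inl v ∈ LV pr ψ → tf v = some d → LEvalU pr (.var v) ψ tf h d
  | hp (v : UVar) (ψ : Lab) (tf : LFrame) (h : Heap) (d : D) :
      Sum.inl v ∉ LV pr ψ → h v = some d → LEvalU pr (.var v) ψ tf h d

/-- The local transition relation `≈>` (Fig. 7).  A local `CEval` whose
operator is a variable has no successor. -/
inductive LStep (pr : ULam) : LState → LState → Prop
  | uea :
      LEvalU pr f l tf h df → ulam ∈ df → LEvalU pr e l tf h d →
      LStep pr (.eval (.u l f e q) tf h) (.applyU ulam d h)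
  | uae_h :
      HVar pr u →
      LStep pr (.applyU (.mk l u k body) d h)
               (.eval body (updL (fun _ => none) u d) (hjoin h u d))
  | uae_s :
      ¬ HVar pr u →
      LStep pr (.applyU (.mk l u k body) d h)
               (.eval body (updL (fun _ => none) u d) h)
  | cea :
      LEvalU pr e g tf h d →
      LStep pr (.eval (.c g (.lam cl) e) tf h) (.applyC (.clam cl) d tf h)
  | cae_h :
      HVar pr u →
      LStep pr (.applyC (.clam (.mk g u body)) d tf h)
               (.eval body (updL tf u d) (hjoin h u d))
  | cae_s :
      ¬ HVar pr u →
      LStep pr (.applyC (.clam (.mk g u body)) d tf h)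
               (.eval body (updL tf u d) h)

/-! ### Classification of local states -/

def LIsEntry : LState → Prop
  | .applyU _ _ _ => True
  | _ => False
def LIsCApply : LState → Prop
  | .applyC _ _ _ _ => True
  | _ => False
def LIsInnerCEval : LState → Prop
  | .eval (.c _ (.lam _) _) _ _ => True
  | _ => False
def LIsExitCEval : LState → Prop
  | .eval (.c _ (.var _) _) _ _ => True
  | _ => False
def LIsCall : LState → Prop
  | .eval (.u _ _ _ (.lam _)) _ _ => True
  | _ => False
def LIsTailCall : LState → Prop
  | .eval (.u _ _ _ (.var _)) _ _ => True
  | _ => False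

/-! ## The summarization algorithm (Fig. 8) -/

/-- `UpdateRes pr ς̃1 ς̃2 ς̃3 ς̃4 ς̃`: `ς̃` is the return state computed by
`Update(ς̃1, ς̃2, ς̃3, ς̃4)` (lines 26–33 of Fig. 8): `ς̃1` is an entry, `ς̃2`
a call in the same procedure, `ς̃3` the entry of the callee, `ς̃4` an
Exit-CEval; the return value is the value of the expression passed to the
continuation, and the caller's frame is restored (with stack filtering when
the operator is a stack reference). -/
inductive UpdateRes (pr : ULam) : LState → LState → LState → LState → LState → Prop
  | filter :
      Sum.inl fv ∈ LV pr l2 →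
      LEvalU pr e4 g4 tf4 h4 d →
      UpdateRes pr
        (.applyU (.mk l1 u1 k1 c1) d1 h1)
        (.eval (.u l2 (.var fv) e2 (.lam (.mk g2 u2 c2))) tf2 h2)
        (.applyU (.mk l3 u3 k3 c3) d3 h2)
        (.eval (.c g4 (.var k4) e4) tf4 h4)
        (.applyC (.clam (.mk g2 u2 c2)) d (updL tf2 fv {ULam.mk l3 u3 k3 c3}) h4)
  | heapref :
      Sum.inl fv ∉ LV pr l2 →
      LEvalU pr e4 g4 tf4 h4 d →
      UpdateRes pr
        (.applyU (.mk l1 u1 k1 c1) d1 h1)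
        (.eval (.u l2 (.var fv) e2 (.lam (.mk g2 u2 c2))) tf2 h2)
        (.applyU (.mk l3 u3 k3 c3) d3 h2)
        (.eval (.c g4 (.var k4) e4) tf4 h4)
        (.applyC (.clam (.mk g2 u2 c2)) d tf2 h4)
  | flam :
      LEvalU pr e4 g4 tf4 h4 d →
      UpdateRes pr
        (.applyU (.mk l1 u1 k1 c1) d1 h1)
        (.eval (.u l2 (.lam fl) e2 (.lam (.mk g2 u2 c2))) tf2 h2)
        (.applyU (.mk l3 u3 k3 c3) d3 h2)
        (.eval (.c g4 (.var k4) e4) tf4 h4)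
        (.applyC (.clam (.mk g2 u2 c2)) d tf2 h4)

/-- A configuration of the summarization algorithm. -/
structure Config where
  Seen : Set (LState × LState)
  W : Set (LState × LState)
  Summary : Set (LState × LState)
  Callers : Set (LState × LState × LState)
  TCallers : Set (LState × LState × LState)
  Final : Set LState

/-- `Propagate`: insert a set of edges into `Seen`, and into the workset
unless already seen. -/
def propagate (c : Config) (W0 : Set (LState × LState))
    (P : Set (LState × LState)) : Config :=
  { c with Seen := c.Seen ∪ P, W := W0 ∪ (P \ c.Seen) }

open Classical in
/-- One iteration of the summarization algorithm: process the edge `e`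
removed from the workset (lines 5–24 of Fig. 8). -/
noncomputable def processEdge (pr : ULam) (ι : LState) (c : Config)
    (e : LState × LState) : Config :=
  let W0 := c.W \ {e}
  match e.2 with
  | .applyU _ _ _ =>
      propagate c W0 {q | ∃ s3, LStep pr e.2 s3 ∧ q = (e.1, s3)}
  | .applyC _ _ _ _ =>
      propagate c W0 {q | ∃ s3, LStep pr e.2 s3 ∧ q = (e.1, s3)}
  | .eval (.c _ (.lam _) _) _ _ =>
      propagate c W0 {q | ∃ s3, LStep pr e.2 s3 ∧ q = (e.1, s3)}
  | .eval (.c g (.var _) ex) tf h =>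
      if e.1 = ι then
        { c with
          W := W0,
          Final := c.Final ∪
            {s | ∃ d, LEvalU pr ex g tf h d ∧
                 s = .applyC .halt d (fun _ => none) h} }
      else
        { propagate c W0
            ({q | ∃ s3 s4 r, (s3, s4, e.1) ∈ c.Callers ∧
                  UpdateRes pr s3 s4 e.1 e.2 r ∧ q = (s3, r)} ∪
             {q | ∃ s3 s4, (s3, s4, e.1) ∈ c.TCallers ∧ q = (s3, e.2)})
          with Summary := c.Summary ∪ {e} }
  | .eval (.u _ _ _ (.lam _)) _ _ =>
      { propagate c W0
          ({q | ∃ s3, LStep pr e.2 s3 ∧ q = (s3, s3)} ∪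
           {q | ∃ s3 s4 r, LStep pr e.2 s3 ∧ (s3, s4) ∈ c.Summary ∧
                UpdateRes pr e.1 e.2 s3 s4 r ∧ q = (e.1, r)})
        with Callers := c.Callers ∪ {tr | ∃ s3, LStep pr e.2 s3 ∧ tr = (e.1, e.2, s3)} }
  | .eval (.u _ _ _ (.var _)) _ _ =>
      { propagate c W0
          ({q | ∃ s3, LStep pr e.2 s3 ∧ q = (s3, s3)} ∪
           {q | ∃ s3 s4, LStep pr e.2 s3 ∧ (s3, s4) ∈ c.Summary ∧ q = (e.1, s4)})
        with TCallers := c.TCallers ∪ {tr | ∃ s3, LStep pr e.2 s3 ∧ tr = (e.1, e.2, s3)} }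

/-- One step of the algorithm: pick any edge in the workset and process it. -/
inductive AlgoStep (pr : ULam) (ι : LState) : Config → Config → Prop
  | step (c : Config) (e : LState × LState) :
      e ∈ c.W → AlgoStep pr ι c (processEdge pr ι c e)

/-- The initial configuration (lines 1–2 of Fig. 8). -/
def initConfig (ι : LState) : Config := ⟨{(ι, ι)}, {(ι, ι)}, ∅, ∅, ∅, ∅⟩

/-- The initial abstract state of a program `pr` on input `inp`. -/
def initA (pr inp : ULam) : AState := .applyU pr {inp} .halt [] (fun _ => none)

/-! ## STATEMENT 14: Termination of the summarization algorithm -/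

/-- Abstract user values drawn from the program. -/
def DOf (pr : ULam) (d : D) : Prop := d ⊆ ULam.subULams pr

/-- Abstract continuations drawn from the program. -/
def CAbsOf (pr : ULam) : CAbs → Prop
  | .halt => True
  | .clam f => f ∈ ULam.subCLams pr

/-- Local frames of the program: supported on the program's user variables,
with values drawn from the program's user lambdas. -/
def LFrameOf (pr : ULam) (tf : LFrame) : Prop :=
  ∀ v, tf v = none ∨
    (Sum.inl v ∈ ULam.bv pr ∧ ∃ d, tf v = some d ∧ DOf pr d)

/-- Heaps of the program. -/
def HeapOf (pr : ULam) (h : Heap) : Prop :=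
  ∀ v, h v = none ∨
    (Sum.inl v ∈ ULam.bv pr ∧ ∃ d, h v = some d ∧ DOf pr d)

/-- The local states of a program: all components are drawn from the
program's (finitely many) subterms. -/
def LStateOf (pr : ULam) : LState → Prop
  | .eval call tf h =>
      call ∈ ULam.subCalls pr ∧ LFrameOf pr tf ∧ HeapOf pr h
  | .applyU f d h =>
      f ∈ ULam.subULams pr ∧ DOf pr d ∧ HeapOf pr h
  | .applyC c d tf h =>
      CAbsOf pr c ∧ DOf pr d ∧ LFrameOf pr tf ∧ HeapOf pr h

/-! ### Closure properties of the sets of subterms -/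

/-- Sets of lambdas, call sites and variables that are closed under taking
immediate constituents. -/
structure SubtermClosed (U : Set ULam) (C : Set CLam) (S : Set Call) (V : Set Var) : Prop where
  ulam_body : ∀ l u k b, ULam.mk l u k b ∈ U → b ∈ S
  ulam_groupVars : ∀ f ∈ U, ULam.groupVars f ⊆ V
  clam_body : ∀ g u b, CLam.mk g u b ∈ C → b ∈ S
  clam_var : ∀ g u b, CLam.mk g u b ∈ C → Sum.inl u ∈ V
  ucall_fun : ∀ l f e q, Call.u l (.lam f) e q ∈ S → f ∈ U
  ucall_arg : ∀ l f e q, Call.u l f (.lam e) q ∈ S → e ∈ U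
  ucall_cont : ∀ l f e q, Call.u l f e (.lam q) ∈ S → q ∈ C
  ccall_cont : ∀ g q e, Call.c g (.lam q) e ∈ S → q ∈ C
  ccall_arg : ∀ g q e, Call.c g q (.lam e) ∈ S → e ∈ U

theorem SubtermClosed.empty : SubtermClosed ∅ ∅ ∅ ∅ := by
  constructor <;> simp

theorem SubtermClosed.union (h₁ : SubtermClosed U₁ C₁ S₁ V₁) (h₂ : SubtermClosed U₂ C₂ S₂ V₂) :
    SubtermClosed (U₁ ∪ U₂) (C₁ ∪ C₂) (S₁ ∪ S₂) (V₁ ∪ V₂) where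
  ulam_body l u k b := Or.imp (h₁.ulam_body l u k b) (h₂.ulam_body l u k b)
  ulam_groupVars f hf := hf.elim
    (fun h => (h₁.ulam_groupVars f h).trans Set.subset_union_left)
    (fun h => (h₂.ulam_groupVars f h).trans Set.subset_union_right)
  clam_body g u b := Or.imp (h₁.clam_body g u b) (h₂.clam_body g u b)
  clam_var g u b := Or.imp (h₁.clam_var g u b) (h₂.clam_var g u b)
  ucall_fun l f e q := Or.imp (h₁.ucall_fun l f e q) (h₂.ucall_fun l f e q)
  ucall_arg l f e q := Or.imp (h₁.ucall_arg l f e q) (h₂.ucall_arg l f e q)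
  ucall_cont l f e q := Or.imp (h₁.ucall_cont l f e q) (h₂.ucall_cont l f e q)
  ccall_cont g q e := Or.imp (h₁.ccall_cont g q e) (h₂.ccall_cont g q e)
  ccall_arg g q e := Or.imp (h₁.ccall_arg g q e) (h₂.ccall_arg g q e)

theorem SubtermClosed.insert_ulam (h : SubtermClosed U C S V) (hb : b ∈ S)
    (hV : ULam.groupVars (.mk l u k b) ⊆ insert (Sum.inl u) (insert (Sum.inr k) V)) :
    SubtermClosed (insert (.mk l u k b) U) C S (insert (Sum.inl u) (insert (Sum.inr k) V)) where
  ulam_body l' u' k' b' := by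
    rintro (h' | h')
    · cases h'; exact hb
    · exact h.ulam_body _ _ _ _ h'
  ulam_groupVars f := by
    rintro (rfl | h')
    · exact hV
    · exact (h.ulam_groupVars f h').trans fun x hx => .inr (.inr hx)
  clam_body := h.clam_body
  clam_var g u' b' h' := .inr (.inr (h.clam_var g u' b' h'))
  ucall_fun l f e q h' := .inr (h.ucall_fun l f e q h')
  ucall_arg l f e q h' := .inr (h.ucall_arg l f e q h')
  ucall_cont := h.ucall_cont
  ccall_cont := h.ccall_cont
  ccall_arg g q e h' := .inr (h.ccall_arg g q e h')

theorem SubtermClosed.insert_clam (h : SubtermClosed U C S V) (hb : b ∈ S) :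
    SubtermClosed U (insert (.mk g u b) C) S (insert (Sum.inl u) V) where
  ulam_body := h.ulam_body
  ulam_groupVars f h' := (h.ulam_groupVars f h').trans (Set.subset_insert _ _)
  clam_body g' u' b' := by
    rintro (h' | h')
    · cases h'; exact hb
    · exact h.clam_body _ _ _ h'
  clam_var g' u' b' := by
    rintro (h' | h')
    · cases h'; exact .inl rfl
    · exact .inr (h.clam_var _ _ _ h')
  ucall_fun := h.ucall_fun
  ucall_arg := h.ucall_arg
  ucall_cont l f e q h' := .inr (h.ucall_cont l f e q h')
  ccall_cont g q e h' := .inr (h.ccall_cont g q e h')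
  ccall_arg := h.ccall_arg

theorem SubtermClosed.insert_ucall (h : SubtermClosed U C S V)
    (hf : ∀ f', f = .lam f' → f' ∈ U) (he : ∀ e', e = .lam e' → e' ∈ U)
    (hq : ∀ q', q = .lam q' → q' ∈ C) :
    SubtermClosed U C (insert (.u l f e q) S) V where
  ulam_body l u k b h' := .inr (h.ulam_body l u k b h')
  ulam_groupVars := h.ulam_groupVars
  clam_body g u b h' := .inr (h.clam_body g u b h')
  clam_var := h.clam_var
  ucall_fun l' f' e' q' := by
    rintro (h' | h')
    · cases h'; exact hf _ rfl
    · exact h.ucall_fun _ _ _ _ h'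
  ucall_arg l' f' e' q' := by
    rintro (h' | h')
    · cases h'; exact he _ rfl
    · exact h.ucall_arg _ _ _ _ h'
  ucall_cont l' f' e' q' := by
    rintro (h' | h')
    · cases h'; exact hq _ rfl
    · exact h.ucall_cont _ _ _ _ h'
  ccall_cont g q e := by
    rintro (h' | h')
    · cases h'
    · exact h.ccall_cont _ _ _ h'
  ccall_arg g q e := by
    rintro (h' | h')
    · cases h'
    · exact h.ccall_arg _ _ _ h'

theorem SubtermClosed.insert_ccall (h : SubtermClosed U C S V)
    (hq : ∀ q', q = .lam q' → q' ∈ C) (he : ∀ e', e = .lam e' → e' ∈ U) :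
    SubtermClosed U C (insert (.c g q e) S) V where
  ulam_body l u k b h' := .inr (h.ulam_body l u k b h')
  ulam_groupVars := h.ulam_groupVars
  clam_body g u b h' := .inr (h.clam_body g u b h')
  clam_var := h.clam_var
  ucall_fun l f e q := by
    rintro (h' | h')
    · cases h'
    · exact h.ucall_fun _ _ _ _ h'
  ucall_arg l f e q := by
    rintro (h' | h')
    · cases h'
    · exact h.ucall_arg _ _ _ _ h'
  ucall_cont l f e q := by
    rintro (h' | h')
    · cases h'
    · exact h.ucall_cont _ _ _ _ h'
  ccall_cont g' q' e' := by
    rintro (h' | h')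
    · cases h'; exact hq _ rfl
    · exact h.ccall_cont _ _ _ h'
  ccall_arg g' q' e' := by
    rintro (h' | h')
    · cases h'; exact he _ rfl
    · exact h.ccall_arg _ _ _ h'

theorem ULam.self_mem_subULams (f : ULam) : f ∈ ULam.subULams f := by
  cases f; simp [ULam.subULams]

theorem CLam.self_mem_subCLams (f : CLam) : f ∈ CLam.subCLams f := by
  cases f; simp [CLam.subCLams]

theorem Call.self_mem_subCalls (c : Call) : c ∈ Call.subCalls c := by
  cases c <;> simp [Call.subCalls]

mutual
  theorem CLam.topVars_subset_bv : ∀ f : CLam, CLam.topVars f ⊆ CLam.bv f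
    | .mk _ _ body => Set.insert_subset_insert (Call.topVars_subset_bv body)
  theorem CExp.topVars_subset_bv : ∀ q : CExp, CExp.topVars q ⊆ CExp.bv q
    | .lam f => CLam.topVars_subset_bv f
    | .var _ => Set.empty_subset _
  theorem Call.topVars_subset_bv : ∀ c : Call, Call.topVars c ⊆ Call.bv c
    | .u _ f e q => by
      have := CExp.topVars_subset_bv q
      cases f <;> cases e <;>
        simpa [Call.topVars, Call.bv, UExp.topVars] using this.trans (by simp)
    | .c _ q e => by
      have := CExp.topVars_subset_bv q
      cases e <;> simpa [Call.topVars, Call.bv, UExp.topVars] using this.trans (by simp)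
end

theorem ULam.groupVars_subset_bv (f : ULam) : ULam.groupVars f ⊆ ULam.bv f := by
  cases f
  exact Set.insert_subset_insert (Set.insert_subset_insert (Call.topVars_subset_bv _))

mutual
  theorem ULam.subtermClosed : ∀ f : ULam,
      SubtermClosed (ULam.subULams f) (ULam.subCLams f) (ULam.subCalls f) (ULam.bv f)
    | .mk _ _ _ body =>
      (Call.subtermClosed body).insert_ulam body.self_mem_subCalls (ULam.groupVars_subset_bv _)
  theorem CLam.subtermClosed : ∀ f : CLam,
      SubtermClosed (CLam.subULams f) (CLam.subCLams f) (CLam.subCalls f) (CLam.bv f)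
    | .mk _ _ body => (Call.subtermClosed body).insert_clam body.self_mem_subCalls
  theorem UExp.subtermClosed : ∀ e : UExp,
      SubtermClosed (UExp.subULams e) (UExp.subCLams e) (UExp.subCalls e) (UExp.bv e)
    | .lam f => ULam.subtermClosed f
    | .var _ => .empty
  theorem CExp.subtermClosed : ∀ q : CExp,
      SubtermClosed (CExp.subULams q) (CExp.subCLams q) (CExp.subCalls q) (CExp.bv q)
    | .lam f => CLam.subtermClosed f
    | .var _ => .empty
  theorem Call.subtermClosed : ∀ c : Call,
      SubtermClosed (Call.subULams c) (Call.subCLams c) (Call.subCalls c) (Call.bv c)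
    | .u _ f e q => by
      refine (((UExp.subtermClosed f).union (UExp.subtermClosed e)).union
        (CExp.subtermClosed q)).insert_ucall ?_ ?_ ?_
      · rintro f' rfl
        exact .inl (.inl f'.self_mem_subULams)
      · rintro e' rfl
        exact .inl (.inr e'.self_mem_subULams)
      · rintro q' rfl
        exact .inr q'.self_mem_subCLams
    | .c _ q e => by
      refine ((CExp.subtermClosed q).union (UExp.subtermClosed e)).insert_ccall ?_ ?_
      · rintro q' rfl
        exact .inl q'.self_mem_subCLams
      · rintro e' rfl
        exact .inr e'.self_mem_subULams
end

/-! ### Finiteness of the set of local states -/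

mutual
  theorem ULam.finite_bv : ∀ f : ULam, (ULam.bv f).Finite
    | .mk _ _ _ body => ((Call.finite_bv body).insert _).insert _
  theorem CLam.finite_bv : ∀ f : CLam, (CLam.bv f).Finite
    | .mk _ _ body => (Call.finite_bv body).insert _
  theorem UExp.finite_bv : ∀ e : UExp, (UExp.bv e).Finite
    | .lam f => ULam.finite_bv f
    | .var _ => Set.finite_empty
  theorem CExp.finite_bv : ∀ q : CExp, (CExp.bv q).Finite
    | .lam f => CLam.finite_bv f
    | .var _ => Set.finite_empty
  theorem Call.finite_bv : ∀ c : Call, (Call.bv c).Finite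
    | .u _ f e q => ((UExp.finite_bv f).union (UExp.finite_bv e)).union (CExp.finite_bv q)
    | .c _ q e => (CExp.finite_bv q).union (UExp.finite_bv e)
end

mutual
  theorem ULam.finite_subULams : ∀ f : ULam, (ULam.subULams f).Finite
    | .mk _ _ _ body => (Call.finite_subULams body).insert _
  theorem CLam.finite_subULams : ∀ f : CLam, (CLam.subULams f).Finite
    | .mk _ _ body => Call.finite_subULams body
  theorem UExp.finite_subULams : ∀ e : UExp, (UExp.subULams e).Finite
    | .lam f => ULam.finite_subULams f
    | .var _ => Set.finite_empty
  theorem CExp.finite_subULams : ∀ q : CExp, (CExp.subULams q).Finite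
    | .lam f => CLam.finite_subULams f
    | .var _ => Set.finite_empty
  theorem Call.finite_subULams : ∀ c : Call, (Call.subULams c).Finite
    | .u _ f e q =>
      ((UExp.finite_subULams f).union (UExp.finite_subULams e)).union (CExp.finite_subULams q)
    | .c _ q e => (CExp.finite_subULams q).union (UExp.finite_subULams e)
end

mutual
  theorem ULam.finite_subCLams : ∀ f : ULam, (ULam.subCLams f).Finite
    | .mk _ _ _ body => Call.finite_subCLams body
  theorem CLam.finite_subCLams : ∀ f : CLam, (CLam.subCLams f).Finite
    | .mk _ _ body => (Call.finite_subCLams body).insert _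
  theorem UExp.finite_subCLams : ∀ e : UExp, (UExp.subCLams e).Finite
    | .lam f => ULam.finite_subCLams f
    | .var _ => Set.finite_empty
  theorem CExp.finite_subCLams : ∀ q : CExp, (CExp.subCLams q).Finite
    | .lam f => CLam.finite_subCLams f
    | .var _ => Set.finite_empty
  theorem Call.finite_subCLams : ∀ c : Call, (Call.subCLams c).Finite
    | .u _ f e q =>
      ((UExp.finite_subCLams f).union (UExp.finite_subCLams e)).union (CExp.finite_subCLams q)
    | .c _ q e => (CExp.finite_subCLams q).union (UExp.finite_subCLams e)
end

mutual
  theorem ULam.finite_subCalls : ∀ f : ULam, (ULam.subCalls f).Finite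
    | .mk _ _ _ body => Call.finite_subCalls body
  theorem CLam.finite_subCalls : ∀ f : CLam, (CLam.subCalls f).Finite
    | .mk _ _ body => Call.finite_subCalls body
  theorem UExp.finite_subCalls : ∀ e : UExp, (UExp.subCalls e).Finite
    | .lam f => ULam.finite_subCalls f
    | .var _ => Set.finite_empty
  theorem CExp.finite_subCalls : ∀ q : CExp, (CExp.subCalls q).Finite
    | .lam f => CLam.finite_subCalls f
    | .var _ => Set.finite_empty
  theorem Call.finite_subCalls : ∀ c : Call, (Call.subCalls c).Finite
    | .u _ f e q => (((UExp.finite_subCalls f).union (UExp.finite_subCalls e)).union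
        (CExp.finite_subCalls q)).insert _
    | .c _ q e => ((CExp.finite_subCalls q).union (UExp.finite_subCalls e)).insert _
end

theorem finite_DOf (pr : ULam) : {d | DOf pr d}.Finite :=
  (ULam.finite_subULams pr).finite_subsets

theorem finite_CAbsOf (pr : ULam) : {c | CAbsOf pr c}.Finite := by
  refine (((ULam.finite_subCLams pr).image CAbs.clam).insert .halt).subset ?_
  rintro (f | _) h
  · exact .inr ⟨f, h, rfl⟩
  · exact .inl rfl

open Classical in
theorem finite_LFrameOf (pr : ULam) : {tf | LFrameOf pr tf}.Finite := by
  have : Finite {v : UVar // Sum.inl v ∈ ULam.bv pr} :=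
    ((ULam.finite_bv pr).preimage Sum.inl_injective.injOn).to_subtype
  have hpi : {g : {v : UVar // Sum.inl v ∈ ULam.bv pr} → Option D |
      ∀ v, g v ∈ insert none (some '' {d | DOf pr d})}.Finite :=
    Set.Finite.pi' fun _ => ((finite_DOf pr).image some).insert none
  refine (hpi.image fun g v => if hv : Sum.inl v ∈ ULam.bv pr then g ⟨v, hv⟩ else none).subset ?_
  intro tf htf
  refine ⟨fun v => tf v, fun v => ?_, funext fun v => ?_⟩
  · rcases htf v with h | ⟨-, d, h, hd⟩
    · exact .inl h
    · exact .inr ⟨d, hd, h.symm⟩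
  · rcases htf v with h | ⟨hv, -⟩
    · simp [h]
    · simp [hv]

theorem finite_HeapOf (pr : ULam) : {h | HeapOf pr h}.Finite := finite_LFrameOf pr

theorem finite_LStateOf (pr : ULam) : {s | LStateOf pr s}.Finite := by
  have hD := finite_DOf pr
  have hF := finite_LFrameOf pr
  have hH := finite_HeapOf pr
  refine ((((ULam.finite_subCalls pr).prod (hF.prod hH)).image
      fun x => LState.eval x.1 x.2.1 x.2.2).union
    ((((ULam.finite_subULams pr).prod (hD.prod hH)).image
      fun x => LState.applyU x.1 x.2.1 x.2.2).union
    (((finite_CAbsOf pr).prod (hD.prod (hF.prod hH))).image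
      fun x => LState.applyC x.1 x.2.1 x.2.2.1 x.2.2.2))).subset ?_
  rintro (⟨c, tf, h⟩ | ⟨f, d, h⟩ | ⟨c, d, tf, h⟩) hs
  · exact .inl ⟨(c, tf, h), hs, rfl⟩
  · exact .inr (.inl ⟨(f, d, h), hs, rfl⟩)
  · exact .inr (.inr ⟨(c, d, tf, h), hs, rfl⟩)

/-! ### The local states of a program are closed under the local semantics -/

theorem LFrameOf.empty (P : ULam) : LFrameOf P fun _ => none := fun _ => .inl rfl

theorem LFrameOf.updL (htf : LFrameOf P tf) (hu : Sum.inl u ∈ ULam.bv P) (hd : DOf P d) :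
    LFrameOf P (updL tf u d) := by
  intro v
  by_cases hv : v = u
  · subst hv
    exact .inr ⟨hu, d, by simp [CFA2.updL], hd⟩
  · simpa [CFA2.updL, hv] using htf v

theorem HeapOf.hjoin (hh : HeapOf P h) (hu : Sum.inl u ∈ ULam.bv P) (hd : DOf P d) :
    HeapOf P (hjoin h u d) := by
  refine LFrameOf.updL hh hu (Set.union_subset hd ?_)
  rcases hh u with h' | ⟨-, d', h', hd'⟩
  · simp [h']
  · rwa [h', Option.getD_some]

theorem LEvalU.DOf (hev : LEvalU pr e l tf h d) (he : ∀ f, e = .lam f → f ∈ ULam.subULams P)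
    (htf : LFrameOf P tf) (hh : HeapOf P h) : DOf P d := by
  cases hev with
  | lam f => exact Set.singleton_subset_iff.2 (he f rfl)
  | stk v _ _ _ _ _ hv =>
    rcases htf v with h' | ⟨-, d', h', hd'⟩ <;> grind
  | hp v _ _ _ _ _ hv =>
    rcases hh v with h' | ⟨-, d', h', hd'⟩ <;> grind

theorem inl_mem_bv_of_mem_subULams (h : ULam.mk l u k b ∈ ULam.subULams P) :
    Sum.inl u ∈ ULam.bv P :=
  (ULam.subtermClosed P).ulam_groupVars _ h (.inl rfl)

theorem LV_subset_bv (pr : ULam) (l : Lab) : LV pr l ⊆ ULam.bv pr := by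
  rintro v ⟨ul, hul, -, hv⟩
  exact (ULam.subtermClosed pr).ulam_groupVars ul hul hv

theorem LStep.LStateOf (hs : LStep pr s s') (h : LStateOf P s) : LStateOf P s' := by
  have hP := ULam.subtermClosed P
  cases hs with
  | uea hf hmem he =>
    obtain ⟨hc, htf, hh⟩ := h
    refine ⟨hf.DOf ?_ htf hh hmem, he.DOf ?_ htf hh, hh⟩
    · rintro f rfl; exact hP.ucall_fun _ _ _ _ hc
    · rintro f rfl; exact hP.ucall_arg _ _ _ _ hc
  | uae_h =>
    obtain ⟨hf, hd, hh⟩ := h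
    have hu := inl_mem_bv_of_mem_subULams hf
    exact ⟨hP.ulam_body _ _ _ _ hf, (LFrameOf.empty P).updL hu hd, hh.hjoin hu hd⟩
  | uae_s =>
    obtain ⟨hf, hd, hh⟩ := h
    exact ⟨hP.ulam_body _ _ _ _ hf,
      (LFrameOf.empty P).updL (inl_mem_bv_of_mem_subULams hf) hd, hh⟩
  | cea he =>
    obtain ⟨hc, htf, hh⟩ := h
    refine ⟨hP.ccall_cont _ _ _ hc, he.DOf ?_ htf hh, htf, hh⟩
    rintro f rfl; exact hP.ccall_arg _ _ _ hc
  | cae_h =>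
    obtain ⟨hc, hd, htf, hh⟩ := h
    have hu := hP.clam_var _ _ _ hc
    exact ⟨hP.clam_body _ _ _ hc, htf.updL hu hd, hh.hjoin hu hd⟩
  | cae_s =>
    obtain ⟨hc, hd, htf, hh⟩ := h
    exact ⟨hP.clam_body _ _ _ hc, htf.updL (hP.clam_var _ _ _ hc) hd, hh⟩

theorem UpdateRes.LStateOf (hr : UpdateRes pr s₁ s₂ s₃ s₄ s) (hpr : ULam.bv pr ⊆ ULam.bv P)
    (h₂ : LStateOf P s₂) (h₃ : LStateOf P s₃) (h₄ : LStateOf P s₄) : LStateOf P s := by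
  have hP := ULam.subtermClosed P
  cases hr with
  | filter hv he =>
    refine ⟨hP.ucall_cont _ _ _ _ h₂.1, he.DOf ?_ h₄.2.1 h₄.2.2,
      h₂.2.1.updL (hpr (LV_subset_bv _ _ hv)) (Set.singleton_subset_iff.2 h₃.1), h₄.2.2⟩
    rintro f rfl; exact hP.ccall_arg _ _ _ h₄.1
  | heapref _ he | flam he =>
    refine ⟨hP.ucall_cont _ _ _ _ h₂.1, he.DOf ?_ h₄.2.1 h₄.2.2, h₂.2.1, h₄.2.2⟩
    rintro f rfl; exact hP.ccall_arg _ _ _ h₄.1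

/-! ### Progress of the algorithm -/

/-- All states recorded by a configuration are local states of `P`, and every
edge of the workset has been marked as seen. -/
structure Config.Inv (P : ULam) (c : Config) : Prop where
  W_subset : c.W ⊆ c.Seen
  seen : ∀ q ∈ c.Seen, LStateOf P q.1 ∧ LStateOf P q.2
  summary : ∀ q ∈ c.Summary, LStateOf P q.1 ∧ LStateOf P q.2
  callers : ∀ q ∈ c.Callers, LStateOf P q.1 ∧ LStateOf P q.2.1
  tcallers : ∀ q ∈ c.TCallers, LStateOf P q.1 ∧ LStateOf P q.2.1

/-- The edges that have been removed from the workset. -/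
def Config.processed (c : Config) : Set (LState × LState) := c.Seen \ c.W

theorem propagate_inv (hc : c.Inv P) (hW : W₀ ⊆ c.Seen)
    (hE : ∀ q ∈ E, LStateOf P q.1 ∧ LStateOf P q.2) : (propagate c W₀ E).Inv P where
  W_subset := Set.union_subset_union hW Set.sdiff_subset
  seen q hq := hq.elim (hc.seen q) (hE q)
  summary := hc.summary
  callers := hc.callers
  tcallers := hc.tcallers

theorem processEdge_inv (hpr : ULam.bv pr ⊆ ULam.bv P) (hc : c.Inv P) (he : e ∈ c.W) :
    (processEdge pr ι c e).Inv P := by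
  have hW : c.W \ {e} ⊆ c.Seen := Set.sdiff_subset.trans hc.W_subset
  obtain ⟨h₁, h₂⟩ := hc.seen e (hc.W_subset he)
  have hstep : ∀ q ∈ {q | ∃ s₃, LStep pr e.2 s₃ ∧ q = (e.1, s₃)},
      LStateOf P q.1 ∧ LStateOf P q.2 := by
    rintro _ ⟨s₃, hs, rfl⟩
    exact ⟨h₁, hs.LStateOf h₂⟩
  have hcall : ∀ q ∈ {q | ∃ s₃, LStep pr e.2 s₃ ∧ q = (e.1, e.2, s₃)},
      LStateOf P q.1 ∧ LStateOf P q.2.1 := by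
    rintro _ ⟨s₃, -, rfl⟩
    exact ⟨h₁, h₂⟩
  unfold processEdge
  split
  · exact propagate_inv hc hW hstep
  · exact propagate_inv hc hW hstep
  · exact propagate_inv hc hW hstep
  · split_ifs
    · exact ⟨hW, hc.seen, hc.summary, hc.callers, hc.tcallers⟩
    · refine { propagate_inv hc hW ?_ with
        summary := fun q hq => hq.elim (hc.summary q) (by rintro rfl; exact ⟨h₁, h₂⟩) }
      rintro _ (⟨s₃, s₄, r, hs, hr, rfl⟩ | ⟨s₃, s₄, hs, rfl⟩)
      · obtain ⟨h₃, h₄⟩ := hc.callers _ hs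
        exact ⟨h₃, hr.LStateOf hpr h₄ h₁ h₂⟩
      · exact ⟨(hc.tcallers _ hs).1, h₂⟩
  · refine { propagate_inv hc hW ?_ with
      callers := fun q hq => hq.elim (hc.callers q) (hcall q) }
    rintro _ (⟨s₃, hs, rfl⟩ | ⟨s₃, s₄, r, -, hs, hr, rfl⟩)
    · exact ⟨hs.LStateOf h₂, hs.LStateOf h₂⟩
    · obtain ⟨h₃, h₄⟩ := hc.summary _ hs
      exact ⟨h₁, hr.LStateOf hpr h₂ h₃ h₄⟩
  · refine { propagate_inv hc hW ?_ with
      tcallers := fun q hq => hq.elim (hc.tcallers q) (hcall q) }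
    rintro _ (⟨s₃, hs, rfl⟩ | ⟨s₃, s₄, -, hs, rfl⟩)
    · exact ⟨hs.LStateOf h₂, hs.LStateOf h₂⟩
    · exact ⟨h₁, (hc.summary _ hs).2⟩

theorem processEdge_exists_propagate (pr : ULam) (ι : LState) (c : Config) (e : LState × LState) :
    ∃ E, (processEdge pr ι c e).Seen = c.Seen ∪ E ∧
      (processEdge pr ι c e).W = c.W \ {e} ∪ (E \ c.Seen) := by
  unfold processEdge
  split
  case h_4 =>
    split_ifs
    · exact ⟨∅, by simp⟩
    · exact ⟨_, rfl, rfl⟩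
  all_goals exact ⟨_, rfl, rfl⟩

theorem processed_ssubset_processEdge (hc : c.W ⊆ c.Seen) (he : e ∈ c.W) :
    c.processed ⊂ (processEdge pr ι c e).processed := by
  obtain ⟨E, hS, hW⟩ := processEdge_exists_propagate pr ι c e
  have heS := hc he
  rw [Config.processed, Config.processed, hS, hW, Set.ssubset_iff_of_subset]
  · exact ⟨e, by simp [heS], by simp [he]⟩
  · rintro q ⟨hq, hqW⟩
    simp [hq, hqW]

theorem AlgoStep.inv (hs : AlgoStep pr ι c c') (hpr : ULam.bv pr ⊆ ULam.bv P) (hc : c.Inv P) :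
    c'.Inv P := by
  cases hs with
  | step e he => exact processEdge_inv hpr hc he

theorem AlgoStep.processed_ssubset (hs : AlgoStep pr ι c c') (hc : c.W ⊆ c.Seen) :
    c.processed ⊂ c'.processed := by
  cases hs with
  | step e he => exact processed_ssubset_processEdge hc he

theorem initConfig_inv (hι : LStateOf P ι) : (initConfig ι).Inv P where
  W_subset := subset_rfl
  seen := by rintro _ rfl; exact ⟨hι, hι⟩
  summary _ h := h.elim
  callers _ h := h.elim
  tcallers _ h := h.elim

theorem not_exists_infinite_run (hpr : ULam.bv pr ⊆ ULam.bv P) (hι : LStateOf P ι) :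
    ¬ ∃ f : ℕ → Config, f 0 = initConfig ι ∧ ∀ n, AlgoStep pr ι (f n) (f (n + 1)) := by
  rintro ⟨f, h0, hstep⟩
  have hinv : ∀ n, (f n).Inv P := by
    intro n
    induction n with
    | zero => exact h0 ▸ initConfig_inv hι
    | succ n ih => exact (hstep n).inv hpr ih
  have hmono : StrictMono fun n => (f n).processed :=
    strictMono_nat_of_lt_succ fun n => (hstep n).processed_ssubset (hinv n).W_subset
  have hfin := ((finite_LStateOf P).prod (finite_LStateOf P)).finite_subsets
  refine Set.infinite_range_of_injective hmono.injective (hfin.subset ?_)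
  rintro _ ⟨n, rfl⟩ q hq
  exact (hinv n).seen q hq.1

/-- A program containing both `pr` and `inp`, whose local states include those
of `pr` running on input `inp`. -/
def joinProgram (pr inp : ULam) : ULam := .mk 0 0 0 (.u 0 (.lam pr) (.lam inp) (.var 0))

theorem bv_subset_bv_joinProgram (pr inp : ULam) :
    ULam.bv pr ⊆ ULam.bv (joinProgram pr inp) :=
  fun _ h => .inr (.inr (.inl (.inl h)))

theorem LStateOf_toLocal_initA (pr inp : ULam) :
    LStateOf (joinProgram pr inp) (toLocal (initA pr inp)) :=
  ⟨.inr (.inl (.inl pr.self_mem_subULams)),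
    Set.singleton_subset_iff.2 (.inr (.inl (.inr inp.self_mem_subULams))), fun _ => .inl rfl⟩

theorem summarization_terminates (pr inp : ULam) :
    -- the set of local states of a program is finite
    ({s : LState | LStateOf pr s}).Finite ∧
    -- and the summarization algorithm halts: there is no infinite run
    ¬ ∃ f : ℕ → Config,
        f 0 = initConfig (toLocal (initA pr inp)) ∧
        ∀ n, AlgoStep pr (toLocal (initA pr inp)) (f n) (f (n + 1)) := by
  exact ⟨finite_LStateOf pr,
    not_exists_infinite_run (bv_subset_bv_joinProgram pr inp) (LStateOf_toLocal_initA pr inp)⟩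

end CFA2
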